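/- Let $X$ be a stochastic process on $[0,T]$ taking values in the bounded interval $[-\gamma,\gamma]$, whose law at each time has a density $p(t,\cdot)$ with $p \in C^{1,1}([0,T]\times[-\gamma,\gamma])$ (jointly, with $\partial_t\partial_x p$ continuous and bounded). Fix $t, t+\Delta t \in [0,T]$ with $\Delta t > 0$, set $\pi = p(t,\cdot)$, $\psi = p(t+\Delta t,\cdot)$, let $\mathbf{m}_L$ be the vector of algebraic moments of orders $0,\dots,L$ of $\psi$, and assume the $L^2$-norm matching $\varphi_2(\mathbf{m}_L,\pi) \geq 0$. Then for every continuous $g$ on $[-\gamma,\gamma]$, $\big|\int g\,\varphi_2(\mathbf{m}_L,\pi)\,dx - \int g\,\psi\,dx\big| \leq \frac{C}{L+1}\Delta t$, where $C$ depends only on $g$, $p$, $T$, and $\gamma$. -/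

import Mathlib

open MeasureTheory intervalIntegral

lemma coefOn_eq (hab : -Real.pi < Real.pi) (f : ℝ → ℂ) (n : ℤ) :
    fourierCoeffOn hab f n = (1 / (2 * Real.pi) : ℂ) *
      ∫ x in (-Real.pi)..Real.pi, Complex.exp (-(Complex.I * n * x)) * f x := by
  rw [fourierCoeffOn_eq_integral]
  rw [Complex.real_smul]
  congr 1
  · push_cast; ring
  · congr 1
    ext x
    rw [fourier_coe_apply, smul_eq_mul]
    congr 2
    have : (Real.pi : ℂ) ≠ 0 := by exact_mod_cast Real.pi_ne_zero
    push_cast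
    field_simp
    ring

lemma int_exp (m : ℤ) : ∫ x in (-Real.pi)..Real.pi, Complex.exp (Complex.I * m * x) =
    if m = 0 then (2 * Real.pi : ℂ) else 0 := by
  split_ifs with h
  · subst h; simp; ring
  · have hm : (Complex.I * m : ℂ) ≠ 0 := by simp [h]
    rw [integral_exp_mul_complex hm]
    have : Complex.exp (Complex.I * m * (Real.pi : ℝ)) = Complex.exp (Complex.I * m * ((-Real.pi : ℝ))) := by
      rw [Complex.exp_eq_exp_iff_exists_int]
      exact ⟨m, by push_cast; ring⟩
    rw [this]; simp

lemma coef_trig (hab : -Real.pi < Real.pi) (f : ℝ → ℂ) (hf : Continuous f) (c : ℤ → ℂ)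
    (s : Finset ℤ) (n : ℤ) :
    fourierCoeffOn hab (fun x => f x - ∑ k ∈ s, c k * Complex.exp (Complex.I * k * x)) n
      = fourierCoeffOn hab f n - if n ∈ s then c n else 0 := by
  have hpi : (Real.pi : ℂ) ≠ 0 := by exact_mod_cast Real.pi_ne_zero
  rw [coefOn_eq, coefOn_eq]
  have : ∀ x : ℝ, Complex.exp (-(Complex.I * n * x)) *
      (f x - ∑ k ∈ s, c k * Complex.exp (Complex.I * k * x)) =
      Complex.exp (-(Complex.I * n * x)) * f x -
        ∑ k ∈ s, c k * Complex.exp (Complex.I * ((k - n : ℤ) : ℂ) * x) := by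
    intro x
    rw [mul_sub, Finset.mul_sum]
    congr 1
    refine Finset.sum_congr rfl fun k _ => ?_
    rw [mul_left_comm, ← Complex.exp_add]
    congr 2
    push_cast; ring
  simp_rw [this]
  rw [intervalIntegral.integral_sub, intervalIntegral.integral_finsetSum]
  · simp_rw [intervalIntegral.integral_const_mul, int_exp]
    rw [mul_sub]
    congr 1
    have : ∀ k : ℤ, (c k * if k - n = 0 then (2 * Real.pi : ℂ) else 0) =
        if k = n then c k * (2 * Real.pi) else 0 := by
      intro k
      by_cases h : k = n
      · simp [h]
      · simp [h, sub_eq_zero]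
    simp_rw [this]
    rw [Finset.sum_ite_eq']
    split_ifs
    · field_simp
    · simp
  · intro k _
    exact (by fun_prop : Continuous fun x : ℝ => c k * Complex.exp (Complex.I * ((k - n : ℤ) : ℂ) * x)).intervalIntegrable _ _
  · exact (by fun_prop : Continuous fun x : ℝ => Complex.exp (-(Complex.I * n * x)) * f x).intervalIntegrable _ _
  · exact (by fun_prop : Continuous fun x : ℝ => ∑ k ∈ s, c k * Complex.exp (Complex.I * ((k - n : ℤ) : ℂ) * x)).intervalIntegrable _ _

lemma coef_even (hab : -Real.pi < Real.pi) (F : ℝ → ℝ) (hF : ∀ x, F (-x) = F x) (n : ℤ) :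
    (fourierCoeffOn hab (fun x => (F x : ℂ)) n).im = 0 := by
  rw [← Complex.conj_eq_iff_im, coefOn_eq, map_mul]
  congr 1
  · have : (1 / (2 * Real.pi) : ℂ) = ((1 / (2 * Real.pi) : ℝ) : ℂ) := by push_cast; ring
    rw [this, Complex.conj_ofReal]
  rw [← intervalIntegral_conj]
  have h := intervalIntegral.integral_comp_neg (a := -Real.pi) (b := Real.pi)
    (fun x : ℝ => Complex.exp (-(Complex.I * n * x)) * (F x : ℂ))
  rw [neg_neg] at h
  rw [← h]
  congr 1
  ext x
  simp [← Complex.exp_conj, hF]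

lemma trig_approx (F F' : ℝ → ℝ) (K : ℝ) (hF : ∀ x, HasDerivAt F (F' x) x)
    (hK : ∀ x, |F' x| ≤ K) (hev : ∀ x, F (-x) = F x) (L : ℕ) :
    ∃ a : ℤ → ℝ, ∫ x in (-Real.pi)..Real.pi,
      (F x - ∑ k ∈ Finset.Icc (-(L : ℤ)) L, a k * Real.cos (k * x)) ^ 2
        ≤ 2 * Real.pi * (K ^ 2 / (L + 1) ^ 2) := by
  have hab : -Real.pi < Real.pi := by linarith [Real.pi_pos]
  have hpi := Real.pi_pos
  have hK0 : 0 ≤ K := (abs_nonneg _).trans (hK 0)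
  have hFc : Continuous F := continuous_iff_continuousAt.2 fun x => (hF x).continuousAt
  set f : ℝ → ℂ := fun x => (F x : ℂ) with hf
  have hfc : Continuous f := Complex.continuous_ofReal.comp hFc
  set f' : ℝ → ℂ := fun x => (F' x : ℂ) with hf'
  have hm : Measurable F' := by
    have : F' = deriv F := funext fun x => (hF x).deriv.symm
    rw [this]; exact measurable_deriv F
  have hm' : Measurable f' := Complex.measurable_ofReal.comp hm
  have hbd : ∀ x, ‖f' x‖ ≤ K := fun x => by simpa [f'] using hK x
  have hmem : MemLp f' 2 (volume.restrict (Set.Ioc (-Real.pi) Real.pi)) :=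
    MemLp.of_bound hm'.aestronglyMeasurable K (ae_of_all _ hbd)
  have hint : IntervalIntegrable f' volume (-Real.pi) Real.pi := by
    rw [intervalIntegrable_iff_integrableOn_Ioc_of_le hab.le]
    exact hmem.integrable (by norm_num)
  set s := Finset.Icc (-(L : ℤ)) L with hs
  set c : ℤ → ℂ := fun n => fourierCoeffOn hab f n with hc
  set G : ℝ → ℂ := fun x => f x - ∑ k ∈ s, c k * Complex.exp (Complex.I * k * x) with hG
  have hGc : Continuous G := by fun_prop
  have hGmem : MemLp G 2 (volume.restrict (Set.Ioc (-Real.pi) Real.pi)) := by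
    obtain ⟨B, hB⟩ := (isCompact_Icc (a := -Real.pi) (b := Real.pi)).exists_bound_of_continuousOn
      hGc.continuousOn
    refine MemLp.of_bound hGc.aestronglyMeasurable B ?_
    filter_upwards [ae_restrict_mem measurableSet_Ioc] with x hx
    exact hB x (Set.Ioc_subset_Icc_self hx)
  have h1 := hasSum_sq_fourierCoeffOn hab hGmem
  have h2 := (hasSum_sq_fourierCoeffOn hab hmem).mul_left (1 / ((L : ℝ) + 1) ^ 2)
  have hle := hasSum_le (fun n => ?_) h1 h2
  swap
  · rw [hG, coef_trig hab f hfc]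
    split_ifs with hn
    · simp [hc]; positivity
    · have hnL : (L : ℝ) + 1 ≤ |(n : ℝ)| := by
        have : (L : ℤ) + 1 ≤ |n| := by
          by_contra h
          apply hn
          rw [hs, Finset.mem_Icc]
          exact abs_le.1 (by omega)
        exact_mod_cast this
      have hLp : (0 : ℝ) < (L : ℝ) + 1 := by positivity
      have hn0 : n ≠ 0 := by
        rintro rfl
        simp at hnL; linarith
      rw [sub_zero, fourierCoeffOn_of_hasDerivAt hab hn0 (f' := f')
        (fun x _ => (hF x).ofReal_comp) hint]
      have e : f Real.pi - f (-Real.pi) = 0 := by simp [hf, hev]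
      rw [e, mul_zero, zero_sub]
      have : ‖1 / (-2 * (Real.pi : ℂ) * Complex.I * n) *
          -((((Real.pi : ℝ) : ℂ) - ((-Real.pi : ℝ) : ℂ)) * fourierCoeffOn hab f' n)‖ =
          ‖fourierCoeffOn hab f' n‖ / |(n : ℝ)| := by
        have : (((Real.pi : ℝ) : ℂ) - ((-Real.pi : ℝ) : ℂ)) = 2 * Real.pi := by push_cast; ring
        rw [this]
        simp [abs_of_pos hpi]
        field_simp
      rw [this, div_pow, one_div, ← div_eq_inv_mul]
      gcongr
  refine ⟨fun n => (c n).re, ?_⟩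
  have hI' : ∫ x in (-Real.pi)..Real.pi, ‖f' x‖ ^ 2 ≤ 2 * Real.pi * K ^ 2 := by
    have := intervalIntegral.norm_integral_le_of_norm_le_const (a := -Real.pi) (b := Real.pi)
      (f := fun x => ‖f' x‖ ^ 2) (C := K ^ 2) (fun x _ => by
        have := hbd x
        rw [norm_pow, norm_norm]; gcongr)
    have h3 := (le_abs_self _).trans this
    rw [abs_of_pos (by linarith)] at h3
    linarith
  have hGI : ∫ x in (-Real.pi)..Real.pi, ‖G x‖ ^ 2 ≤ 2 * Real.pi * (K ^ 2 / (L + 1) ^ 2) := by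
    rw [smul_eq_mul, smul_eq_mul] at hle
    have e : Real.pi - -Real.pi = 2 * Real.pi := by ring
    rw [e, inv_mul_le_iff₀ (by positivity)] at hle
    refine hle.trans ?_
    have : 2 * Real.pi * (1 / ((L : ℝ) + 1) ^ 2 * ((2 * Real.pi)⁻¹ * ∫ x in (-Real.pi)..Real.pi, ‖f' x‖ ^ 2))
      = 1 / ((L : ℝ) + 1) ^ 2 * ∫ x in (-Real.pi)..Real.pi, ‖f' x‖ ^ 2 := by field_simp
    rw [this]
    calc _ ≤ 1 / ((L : ℝ) + 1) ^ 2 * (2 * Real.pi * K ^ 2) := by gcongr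
      _ = _ := by ring
  refine le_trans ?_ hGI
  apply intervalIntegral.integral_mono_on hab.le
  · exact (by fun_prop : Continuous fun x : ℝ => (F x - ∑ k ∈ s, (c k).re * Real.cos (k * x)) ^ 2).intervalIntegrable _ _
  · exact (by fun_prop : Continuous fun x : ℝ => ‖G x‖ ^ 2).intervalIntegrable _ _
  intro x _
  have : F x - ∑ k ∈ s, (c k).re * Real.cos (k * x) = (G x).re := by
    rw [hG]
    simp only [Complex.sub_re, Complex.re_sum, hf, Complex.ofReal_re]
    congr 1
    refine Finset.sum_congr rfl fun k _ => ?_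
    have e : Complex.I * k * x = ((k * x : ℝ) : ℂ) * Complex.I := by push_cast; ring
    rw [Complex.mul_re, coef_even hab F hev k, e, Complex.exp_ofReal_mul_I_re]
    ring
  rw [this]
  have := Complex.abs_re_le_norm (G x)
  rw [← sq_abs]; gcongr

lemma jackson (γ : ℝ) (hγ : 0 < γ) (f f' : ℝ → ℝ) (K : ℝ)
    (hf : ∀ x ∈ Set.Icc (-γ) γ, HasDerivAt f (f' x) x)
    (hK : ∀ x ∈ Set.Icc (-γ) γ, |f' x| ≤ K) (L : ℕ) :
    ∃ q : Polynomial ℝ, q.natDegree ≤ L ∧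
      ∫ x in (-γ)..γ, (f x - q.eval x) ^ 2 ≤ γ * (2 * Real.pi * ((γ * K) ^ 2 / (L + 1) ^ 2)) := by
  have hpi := Real.pi_pos
  have hmem : ∀ θ : ℝ, γ * Real.cos θ ∈ Set.Icc (-γ) γ := fun θ =>
    ⟨by nlinarith [Real.neg_one_le_cos θ], by nlinarith [Real.cos_le_one θ]⟩
  have hd : ∀ θ : ℝ, HasDerivAt (fun θ => γ * Real.cos θ) (γ * -Real.sin θ) θ := fun θ =>
    (Real.hasDerivAt_cos θ).const_mul γ
  obtain ⟨a, ha⟩ := trig_approx (fun θ => f (γ * Real.cos θ))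
    (fun θ => f' (γ * Real.cos θ) * (γ * -Real.sin θ)) (γ * K)
    (fun θ => (hf _ (hmem θ)).comp θ (hd θ))
    (fun θ => by
      rw [abs_mul, abs_mul, abs_neg, abs_of_pos hγ]
      have h1 := hK _ (hmem θ)
      have h2 := Real.abs_sin_le_one θ
      have h0 := abs_nonneg (f' (γ * Real.cos θ))
      calc _ ≤ K * (γ * 1) := by gcongr; linarith
        _ = _ := by ring)
    (fun θ => by simp) L
  set q : Polynomial ℝ := ∑ k ∈ Finset.Icc (-(L : ℤ)) L,
    Polynomial.C (a k) * (Polynomial.Chebyshev.T ℝ k).comp (Polynomial.C γ⁻¹ * Polynomial.X) with hq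
  have hqe : ∀ θ : ℝ, q.eval (γ * Real.cos θ) =
      ∑ k ∈ Finset.Icc (-(L : ℤ)) L, a k * Real.cos (k * θ) := by
    intro θ
    rw [hq, Polynomial.eval_finsetSum]
    refine Finset.sum_congr rfl fun k _ => ?_
    rw [Polynomial.eval_mul, Polynomial.eval_C, Polynomial.eval_comp, Polynomial.eval_mul,
      Polynomial.eval_C, Polynomial.eval_X, inv_mul_cancel_left₀ hγ.ne',
      Polynomial.Chebyshev.T_real_cos]
  refine ⟨q, ?_, ?_⟩
  · refine Polynomial.natDegree_sum_le_of_forall_le _ _ fun k hk => ?_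
    refine (Polynomial.natDegree_C_mul_le _ _).trans ?_
    refine Polynomial.natDegree_comp_le.trans ?_
    have h1 : (Polynomial.Chebyshev.T ℝ k).natDegree ≤ L := by
      rw [Polynomial.natDegree_eq_of_degree_eq_some (Polynomial.Chebyshev.degree_T ℝ k)]
      rw [Finset.mem_Icc] at hk
      omega
    have h2 : (Polynomial.C γ⁻¹ * Polynomial.X : Polynomial ℝ).natDegree ≤ 1 :=
      (Polynomial.natDegree_C_mul_le _ _).trans Polynomial.natDegree_X_le
    nlinarith
  · have hfc : ContinuousOn f (Set.Icc (-γ) γ) := fun x hx =>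
      (hf x hx).continuousAt.continuousWithinAt
    have hcont : ContinuousOn (fun x => (f x - q.eval x) ^ 2) (Set.Icc (-γ) γ) :=
      (hfc.sub q.continuous.continuousOn).pow 2
    have hsub := integral_comp_mul_deriv' (a := 0) (b := Real.pi) (f := fun θ => γ * Real.cos θ)
      (f' := fun θ => γ * -Real.sin θ) (g := fun x => (f x - q.eval x) ^ 2)
      (fun θ _ => hd θ) (by fun_prop) (hcont.mono (by rintro _ ⟨θ, _, rfl⟩; exact hmem θ))
    simp only [Real.cos_zero, Real.cos_pi, mul_one, mul_neg, Function.comp_def] at hsub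
    rw [intervalIntegral.integral_symm, ← hsub, ← intervalIntegral.integral_neg]
    have hFc : Continuous fun θ => f (γ * Real.cos θ) - q.eval (γ * Real.cos θ) :=
      (hfc.comp_continuous (by fun_prop) hmem).sub (q.continuous.comp (by fun_prop))
    have hFc2 : Continuous fun θ => (f (γ * Real.cos θ) - q.eval (γ * Real.cos θ)) ^ 2 := hFc.pow 2
    calc _ ≤ ∫ θ in (0:ℝ)..Real.pi, γ * (f (γ * Real.cos θ) - q.eval (γ * Real.cos θ)) ^ 2 := by
          apply intervalIntegral.integral_mono_on hpi.le
          · exact (by fun_prop : Continuous _).intervalIntegrable _ _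
          · exact (by fun_prop : Continuous _).intervalIntegrable _ _
          intro θ _
          have := Real.sin_le_one θ
          have h0 := mul_nonneg hγ.le (sq_nonneg (f (γ * Real.cos θ) - q.eval (γ * Real.cos θ)))
          nlinarith
      _ ≤ ∫ θ in (-Real.pi)..Real.pi, γ * (f (γ * Real.cos θ) - q.eval (γ * Real.cos θ)) ^ 2 := by
          apply intervalIntegral.integral_mono_interval (by linarith) hpi.le le_rfl
          · exact ae_of_all _ fun θ => by simp only [Pi.zero_apply]; positivity
          · exact (by fun_prop : Continuous _).intervalIntegrable _ _
      _ ≤ _ := by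
          rw [intervalIntegral.integral_const_mul]
          simp_rw [hqe]
          gcongr

lemma core_bound (γ : ℝ) (hγ : 0 < γ) (φ ψ π g : ℝ → ℝ) (q : Polynomial ℝ) (L : ℕ)
    (hψ : ContinuousOn ψ (Set.Icc (-γ) γ)) (hπ : ContinuousOn π (Set.Icc (-γ) γ))
    (hg : ContinuousOn g (Set.Icc (-γ) γ))
    (hφ2 : IntervalIntegrable (fun x => (φ x) ^ 2) volume (-γ) γ)
    (hφ0 : ∀ x ∈ Set.Icc (-γ) γ, 0 ≤ φ x)
    (hmom : ∀ l : Fin (L + 1), (∫ x in (-γ)..γ, x ^ (l : ℕ) * φ x) =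
      ∫ x in (-γ)..γ, x ^ (l : ℕ) * ψ x)
    (hmin : ∫ x in (-γ)..γ, (φ x - π x) ^ 2 ≤ ∫ x in (-γ)..γ, (ψ x - π x) ^ 2)
    (hq : q.natDegree ≤ L) (D lam : ℝ) (hlam : 0 < lam)
    (hB : ∫ x in (-γ)..γ, ((ψ x - π x) - q.eval x) ^ 2 ≤ D * lam ^ 2) :
    |(∫ x in (-γ)..γ, g x * φ x) - ∫ x in (-γ)..γ, g x * ψ x|
      ≤ ((∫ x in (-γ)..γ, g x ^ 2) / 2 + 2 * D) * lam := by
  have hab : -γ ≤ γ := by linarith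
  rw [intervalIntegrable_iff_integrableOn_Ioc_of_le hab] at hφ2
  simp only [intervalIntegral.integral_of_le hab] at *
  set μ := volume.restrict (Set.Ioc (-γ) γ) with hμ
  have hc : ∀ f : ℝ → ℝ, ContinuousOn f (Set.Icc (-γ) γ) → MemLp f 2 μ := by
    intro f hf
    obtain ⟨B, hB⟩ := (isCompact_Icc (a := -γ) (b := γ)).exists_bound_of_continuousOn hf
    refine MemLp.of_bound ((hf.mono Set.Ioc_subset_Icc_self).aestronglyMeasurable
      measurableSet_Ioc) B ?_
    filter_upwards [ae_restrict_mem measurableSet_Ioc] with x hx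
    exact hB x (Set.Ioc_subset_Icc_self hx)
  have hφm : AEStronglyMeasurable φ μ := by
    have h1 : AEStronglyMeasurable (fun x => Real.sqrt ((φ x) ^ 2)) μ :=
      Real.continuous_sqrt.comp_aestronglyMeasurable hφ2.aestronglyMeasurable
    refine h1.congr ?_
    filter_upwards [ae_restrict_mem measurableSet_Ioc] with x hx
    exact Real.sqrt_sq (hφ0 x (Set.Ioc_subset_Icc_self hx))
  have hφ : MemLp φ 2 μ := (memLp_two_iff_integrable_sq hφm).2 hφ2
  have hψ' := hc ψ hψ
  have hπ' := hc π hπ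
  have hg' := hc g hg
  have hq' : MemLp (fun x => q.eval x) 2 μ := hc _ q.continuous.continuousOn
  have he : MemLp (fun x => φ x - ψ x) 2 μ := hφ.sub hψ'
  have hf : MemLp (fun x => ψ x - π x) 2 μ := hψ'.sub hπ'
  have hr : MemLp (fun x => ψ x - π x - q.eval x) 2 μ := hf.sub hq'
  have hmul : ∀ u v : ℝ → ℝ, MemLp u 2 μ → MemLp v 2 μ → Integrable (fun x => u x * v x) μ :=
    fun u v hu hv => hu.integrable_mul hv
  have horth : ∫ x, q.eval x * (φ x - ψ x) ∂μ = 0 := by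
    have : ∀ x, q.eval x * (φ x - ψ x) =
        ∑ i ∈ Finset.range (L + 1), q.coeff i * (x ^ i * φ x - x ^ i * ψ x) := by
      intro x
      rw [Polynomial.eval_eq_sum_range' (Nat.lt_succ_of_le hq), Finset.sum_mul]
      refine Finset.sum_congr rfl fun i _ => ?_
      ring
    simp_rw [this]
    have hx : ∀ i : ℕ, MemLp (fun x : ℝ => x ^ i) 2 μ := fun i => hc _ (by fun_prop)
    rw [MeasureTheory.integral_finsetSum]
    · refine Finset.sum_eq_zero fun i hi => ?_
      rw [MeasureTheory.integral_const_mul,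
        MeasureTheory.integral_sub (hmul _ _ (hx i) hφ) (hmul _ _ (hx i) hψ')]
      have := hmom ⟨i, Finset.mem_range.1 hi⟩
      simp only at this
      rw [this]; ring
    · intro i _
      exact ((hmul _ _ (hx i) hφ).sub (hmul _ _ (hx i) hψ')).const_mul _
  have hee : Integrable (fun x => (φ x - ψ x) ^ 2) μ := he.integrable_sq
  have hef := hmul _ _ he hf
  have her := hmul _ _ he hr
  have hA : ∫ x, (φ x - ψ x) ^ 2 ∂μ ≤ 4 * (D * lam ^ 2) := by
    have e1 : ∫ x, (φ x - π x) ^ 2 ∂μ = ∫ x, (φ x - ψ x) ^ 2 ∂μ +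
        2 * (∫ x, (φ x - ψ x) * (ψ x - π x) ∂μ) + ∫ x, (ψ x - π x) ^ 2 ∂μ := by
      have hsum : Integrable (fun x => (φ x - ψ x) ^ 2 + 2 * ((φ x - ψ x) * (ψ x - π x))) μ :=
        hee.add (hef.const_mul 2)
      rw [← MeasureTheory.integral_const_mul, ← MeasureTheory.integral_add hee (hef.const_mul 2),
        ← MeasureTheory.integral_add hsum hf.integrable_sq]
      congr 1; ext x; ring
    have e2 : ∫ x, (φ x - ψ x) * (ψ x - π x) ∂μ =
        ∫ x, (φ x - ψ x) * (ψ x - π x - q.eval x) ∂μ := by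
      rw [← sub_eq_zero, ← MeasureTheory.integral_sub hef her, ← horth]
      congr 1; ext x; ring
    have e3 : -(∫ x, (φ x - ψ x) * (ψ x - π x - q.eval x) ∂μ) ≤
        (1 / 4) * ∫ x, (φ x - ψ x) ^ 2 ∂μ + ∫ x, (ψ x - π x - q.eval x) ^ 2 ∂μ := by
      rw [← MeasureTheory.integral_const_mul, ← MeasureTheory.integral_neg,
        ← MeasureTheory.integral_add (hee.const_mul _) hr.integrable_sq]
      refine MeasureTheory.integral_mono her.neg ((hee.const_mul _).add hr.integrable_sq) fun x => ?_
      simp only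
      nlinarith [sq_nonneg ((φ x - ψ x) / 2 + (ψ x - π x - q.eval x))]
    linarith
  have hge := hmul _ _ hg' he
  rw [← MeasureTheory.integral_sub (hmul _ _ hg' hφ) (hmul _ _ hg' hψ')]
  have e4 : ∫ x, (g x * φ x - g x * ψ x) ∂μ = ∫ x, g x * (φ x - ψ x) ∂μ := by
    congr 1; ext x; ring
  rw [e4]
  calc |∫ x, g x * (φ x - ψ x) ∂μ| ≤ ∫ x, |g x * (φ x - ψ x)| ∂μ := abs_integral_le_integral_abs
    _ ≤ ∫ x, (lam / 2 * g x ^ 2 + 1 / (2 * lam) * (φ x - ψ x) ^ 2) ∂μ := by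
        refine MeasureTheory.integral_mono hge.abs
          ((hg'.integrable_sq.const_mul _).add (hee.const_mul _)) fun x => ?_
        simp only
        rw [abs_mul]
        have h1 : lam / 2 * g x ^ 2 + 1 / (2 * lam) * (φ x - ψ x) ^ 2 - |g x| * |φ x - ψ x| =
            1 / (2 * lam) * (lam * |g x| - |φ x - ψ x|) ^ 2 := by
          rw [← sq_abs (g x), ← sq_abs (φ x - ψ x)]
          field_simp
          ring
        have : 0 ≤ 1 / (2 * lam) * (lam * |g x| - |φ x - ψ x|) ^ 2 := by positivity
        linarith
    _ = lam / 2 * ∫ x, g x ^ 2 ∂μ + 1 / (2 * lam) * ∫ x, (φ x - ψ x) ^ 2 ∂μ := by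
        rw [MeasureTheory.integral_add (hg'.integrable_sq.const_mul _) (hee.const_mul _),
          MeasureTheory.integral_const_mul, MeasureTheory.integral_const_mul]
    _ ≤ lam / 2 * ∫ x, g x ^ 2 ∂μ + 1 / (2 * lam) * (4 * (D * lam ^ 2)) := by gcongr
    _ = _ := by field_simp; ring

/-- Consistency of the `L²`-norm matching along a smooth family of densities:
if `p(t,·)` are probability densities on `[-γ,γ]`, smooth in `(t,x)` with
bounded mixed derivative `∂ₜ∂ₓp`, `π = p(t,·)`, `ψ = p(t+Δt,·)`, and the
matching `φ₂(m_L, π)` of `π` to the moments of orders `0,…,L` of `ψ` is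
nonnegative, then for every continuous `g`,
`|∫ g φ₂(m_L,π) - ∫ g ψ| ≤ C Δt / (L+1)` with `C = C(g, p, T, γ)`. -/
theorem l2_matching_observable_error
    (γ T : ℝ) (hγ : 0 < γ) (hT : 0 < T)
    (p px ptx : ℝ → ℝ → ℝ)
    (hpx : ∀ t ∈ Set.Icc 0 T, ∀ x ∈ Set.Icc (-γ) γ, HasDerivAt (fun y => p t y) (px t x) x)
    (hptx : ∀ t ∈ Set.Icc 0 T, ∀ x ∈ Set.Icc (-γ) γ, HasDerivAt (fun s => px s x) (ptx t x) t)
    (hptx_cont : Continuous fun q : ℝ × ℝ => ptx q.1 q.2)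
    (hptx_bdd : ∃ M : ℝ, ∀ t ∈ Set.Icc 0 T, ∀ x ∈ Set.Icc (-γ) γ, |ptx t x| ≤ M)
    (hp_nonneg : ∀ t ∈ Set.Icc 0 T, ∀ x ∈ Set.Icc (-γ) γ, 0 ≤ p t x)
    (hp_mass : ∀ t ∈ Set.Icc 0 T, ∫ x in (-γ)..γ, p t x = 1)
    (g : ℝ → ℝ) (hg : ContinuousOn g (Set.Icc (-γ) γ)) :
    ∃ C : ℝ, ∀ (L : ℕ) (t Δt : ℝ), 0 < Δt → t ∈ Set.Icc 0 T → t + Δt ∈ Set.Icc 0 T →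
      ∀ m : Fin (L + 1) → ℝ,
        (∀ l, m l = ∫ x in (-γ)..γ, x ^ (l : ℕ) * p (t + Δt) x) →
      ∀ φ : ℝ → ℝ,
        IntervalIntegrable (fun x => (φ x) ^ 2) volume (-γ) γ →
        (∀ l : Fin (L + 1), (∫ x in (-γ)..γ, x ^ (l : ℕ) * φ x) = m l) →
        (∀ h : ℝ → ℝ, IntervalIntegrable (fun x => (h x) ^ 2) volume (-γ) γ →
          (∀ l : Fin (L + 1), (∫ x in (-γ)..γ, x ^ (l : ℕ) * h x) = m l) →
          (1 / 2) * (∫ x in (-γ)..γ, (φ x - p t x) ^ 2)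
            ≤ (1 / 2) * ∫ x in (-γ)..γ, (h x - p t x) ^ 2) →
        (∀ x ∈ Set.Icc (-γ) γ, 0 ≤ φ x) →
        |(∫ x in (-γ)..γ, g x * φ x) - ∫ x in (-γ)..γ, g x * p (t + Δt) x|
          ≤ C / (L + 1) * Δt := by
  obtain ⟨M, hM⟩ := hptx_bdd
  refine ⟨(∫ x in (-γ)..γ, g x ^ 2) / 2 + 2 * (γ * (2 * Real.pi * (γ * M) ^ 2)), ?_⟩
  intro L t Δt hΔ ht ht' m hm φ hφ2 hmom hmin hφ0
  have hcont : ∀ s ∈ Set.Icc 0 T, ContinuousOn (p s) (Set.Icc (-γ) γ) := fun s hs x hx =>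
    (hpx s hs x hx).continuousAt.continuousWithinAt
  obtain ⟨q, hq, hB⟩ := jackson γ hγ (fun x => p (t + Δt) x - p t x)
    (fun x => px (t + Δt) x - px t x) (M * Δt)
    (fun x hx => (hpx _ ht' x hx).sub (hpx _ ht x hx))
    (fun x hx => by
      have := Convex.norm_image_sub_le_of_norm_hasDerivWithin_le (f := fun s => px s x)
        (f' := fun s => ptx s x) (s := Set.Icc 0 T) (C := M)
        (fun s hs => (hptx s hs x hx).hasDerivWithinAt) (fun s hs => hM s hs x hx)
        (convex_Icc 0 T) ht ht'
      simpa [abs_of_pos hΔ] using this) L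
  have hmin' := hmin (p (t + Δt))
    (((hcont _ ht').pow 2).intervalIntegrable_of_Icc (by linarith)) (fun l => (hm l).symm)
  have hL : (0 : ℝ) < (L : ℝ) + 1 := by positivity
  have := core_bound γ hγ φ (p (t + Δt)) (p t) g q L (hcont _ ht') (hcont _ ht) hg hφ2 hφ0
    (fun l => (hmom l).trans (hm l)) (by linarith) hq (γ * (2 * Real.pi * (γ * M) ^ 2))
    (Δt / (L + 1)) (by positivity) (hB.trans (le_of_eq (by field_simp)))
  refine this.trans (le_of_eq ?_)
  ring
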